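/- arXiv:1512.07478 — 2 statements merged into one kernel-verified Lean document; each statement's English description precedes it below -/
import Mathlib

section
/- Let X be a Baire space, Y and Z compact spaces, and f : X × (Y × Z) → ℝ quasi-continuous in the first variable and continuous in the second variable. Suppose that for every y ∈ Y the function (x,z) ↦ f(x,y,z) on X × Z has the Namioka property, and for every z ∈ Z the function (x,y) ↦ f(x,y,z) on X × Y has the Namioka property. Then f has the Namioka property on X × (Y × Z). -/
open Topology

/-- A map is quasi-continuous at `x₀` if every neighborhood of `x₀` contains a nonempty open
set mapped into any prescribed neighborhood of `f x₀`. -/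
def QuasiContinuousAt {X Y : Type*} [TopologicalSpace X] [TopologicalSpace Y]
    (f : X → Y) (x₀ : X) : Prop :=
  ∀ U ∈ 𝓝 x₀, ∀ V ∈ 𝓝 (f x₀), ∃ G : Set X, IsOpen G ∧ G.Nonempty ∧ G ⊆ U ∧ f '' G ⊆ V

/-- A map is quasi-continuous if it is quasi-continuous at every point. -/
def QuasiContinuous {X Y : Type*} [TopologicalSpace X] [TopologicalSpace Y]
    (f : X → Y) : Prop :=
  ∀ x : X, QuasiContinuousAt f x

/-- `f : X × Y → Z` has the Namioka property if there is a dense `Gδ` set `A ⊆ X` such that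
`f` is jointly continuous at every point of `A × Y`. -/
def NamiokaProperty {X Y Z : Type*} [TopologicalSpace X] [TopologicalSpace Y]
    [TopologicalSpace Z] (f : X × Y → Z) : Prop :=
  ∃ A : Set X, Dense A ∧ IsGδ A ∧ ∀ x ∈ A, ∀ y : Y, ContinuousAt f (x, y)

/-- `Y` is a Kempisty space if for every Baire space `X`, every `f : X × Y → ℝ`
quasi-continuous in the first variable and continuous in the second has the Namioka property. -/
def KempistySpace (Y : Type*) [TopologicalSpace Y] : Prop :=
  ∀ (X : Type*) (_ : TopologicalSpace X), BaireSpace X →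
    ∀ f : X × Y → ℝ,
      (∀ y : Y, QuasiContinuous fun x => f (x, y)) →
      (∀ x : X, Continuous fun y => f (x, y)) →
      NamiokaProperty f

/-- Namioka property with compact fibre gives small uniform oscillation on small open sets. -/
lemma namioka_small_osc {X K : Type*} [TopologicalSpace X] [TopologicalSpace K] [CompactSpace K]
    {g : X × K → ℝ} (hg : NamiokaProperty g) {V : Set X} (hV : IsOpen V) (hne : V.Nonempty)
    {δ : ℝ} (hδ : 0 < δ) :
    ∃ W : Set X, IsOpen W ∧ W.Nonempty ∧ W ⊆ V ∧
      ∀ x ∈ W, ∀ x' ∈ W, ∀ k, |g (x, k) - g (x', k)| ≤ δ := by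
  obtain ⟨A, hA, -, hc⟩ := hg
  obtain ⟨a, haV, haA⟩ := hA.inter_open_nonempty V hV hne
  have h1 : ∀ᶠ x in 𝓝 a, ∀ k ∈ (Set.univ : Set K), |g (x, k) - g (a, k)| < δ / 2 := by
    apply isCompact_univ.eventually_forall_of_forall_eventually
    intro k _
    have hc1 : ContinuousAt (fun q : X × K => g (q.1, q.2)) (a, k) := hc a haA k
    have hc2 : ContinuousAt (fun q : X × K => g (a, q.2)) (a, k) := by
      have h3 : ContinuousAt (fun q : X × K => (a, q.2)) (a, k) := by fun_prop
      exact ContinuousAt.comp (f := fun q : X × K => (a, q.2)) (g := g) (hc a haA k) h3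
    have h4 := (hc1.sub hc2).abs
    have h5 := h4.eventually_lt (continuousAt_const (y := δ / 2)) (by simpa using hδ)
    exact h5
  obtain ⟨O, hO, hOo, haO⟩ := eventually_nhds_iff.mp h1
  refine ⟨O ∩ V, hOo.inter hV, ⟨a, haO, haV⟩, Set.inter_subset_right, ?_⟩
  intro x hx x' hx' k
  have e1 := abs_lt.mp (hO x hx.1 k trivial)
  have e2 := abs_lt.mp (hO x' hx'.1 k trivial)
  rw [abs_le]
  constructor <;> linarith [e1.1, e1.2, e2.1, e2.2]

lemma namioka_small_osc_finset {X K ι : Type*} [TopologicalSpace X] [TopologicalSpace K]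
    [CompactSpace K] (g : ι → X × K → ℝ) (hg : ∀ i, NamiokaProperty (g i)) (s : Finset ι)
    {V : Set X} (hV : IsOpen V) (hne : V.Nonempty) {δ : ℝ} (hδ : 0 < δ) :
    ∃ W : Set X, IsOpen W ∧ W.Nonempty ∧ W ⊆ V ∧
      ∀ i ∈ s, ∀ x ∈ W, ∀ x' ∈ W, ∀ k, |g i (x, k) - g i (x', k)| ≤ δ := by
  classical
  induction s using Finset.induction_on with
  | empty => exact ⟨V, hV, hne, subset_rfl, by simp⟩
  | insert i s hi ih =>
    obtain ⟨W, hW, hWne, hWV, h⟩ := ih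
    obtain ⟨W', hW', hWne', hWV', h'⟩ := namioka_small_osc (hg i) hW hWne hδ
    refine ⟨W', hW', hWne', hWV'.trans hWV, ?_⟩
    intro j hj x hx x' hx' k
    rcases Finset.mem_insert.mp hj with rfl | hj
    · exact h' x hx x' hx' k
    · exact h j hj x (hWV' hx) x' (hWV' hx') k

lemma namioka_of_small_osc {X K : Type*} [TopologicalSpace X] [BaireSpace X] [TopologicalSpace K]
    {g : X × K → ℝ} (hg : ∀ x, Continuous fun k => g (x, k))
    (h : ∀ δ : ℝ, 0 < δ → ∀ V : Set X, IsOpen V → V.Nonempty →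
      ∃ W : Set X, IsOpen W ∧ W.Nonempty ∧ W ⊆ V ∧
      ∀ x ∈ W, ∀ x' ∈ W, ∀ k, |g (x, k) - g (x', k)| ≤ δ) : NamiokaProperty g := by
  let O : ℕ → Set X := fun n => ⋃₀ {W : Set X | IsOpen W ∧
    ∀ x ∈ W, ∀ x' ∈ W, ∀ k, |g (x, k) - g (x', k)| ≤ 1 / ((n : ℝ) + 1)}
  have hO : ∀ n, IsOpen (O n) := fun n => isOpen_sUnion fun W hW => hW.1
  have hD : ∀ n, Dense (O n) := by
    intro n
    rw [dense_iff_inter_open]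
    intro V hV hne
    obtain ⟨W, hW, ⟨w, hw⟩, hWV, hosc⟩ := h (1 / ((n : ℝ) + 1)) (by positivity) V hV hne
    exact ⟨w, hWV hw, W, ⟨hW, hosc⟩, hw⟩
  refine ⟨⋂ n, O n, dense_iInter_of_isOpen hO hD, IsGδ.iInter_of_isOpen hO, ?_⟩
  intro x hx p
  rw [Metric.continuousAt_iff']
  intro ε hε
  obtain ⟨n, hn⟩ := exists_nat_one_div_lt (half_pos hε)
  obtain ⟨W, ⟨hW, hosc⟩, hxW⟩ := Set.mem_iInter.mp hx n
  have e1 : ∀ᶠ q : X × K in 𝓝 (x, p), q.1 ∈ W :=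
    continuousAt_fst.eventually (hW.mem_nhds hxW)
  have e2 : ∀ᶠ q : X × K in 𝓝 (x, p), |g (x, q.2) - g (x, p)| < ε / 2 := by
    have hc : Continuous fun q : X × K => g (x, q.2) := (hg x).comp continuous_snd
    exact Metric.continuousAt_iff'.mp (hc.continuousAt (x := (x, p))) _ (half_pos hε)
  filter_upwards [e1, e2] with q h1 h2
  have h3 := hosc q.1 h1 x hxW q.2
  rw [Real.dist_eq]
  have h4 := abs_sub_le (g q) (g (x, q.2)) (g (x, p))
  have h5 : |g q - g (x, q.2)| ≤ 1 / ((n : ℝ) + 1) := h3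
  linarith

lemma exists_net {Y Z : Type*} [TopologicalSpace Y] [CompactSpace Y] [TopologicalSpace Z]
    [CompactSpace Z] {g : Y × Z → ℝ} (hg : Continuous g) {δ : ℝ} (hδ : 0 < δ) :
    ∃ t : Finset Y, ∀ y, ∃ y' ∈ t, ∀ z, |g (y, z) - g (y', z)| < δ := by
  have h : ∀ y₀ : Y, {y : Y | ∀ z, |g (y, z) - g (y₀, z)| < δ} ∈ 𝓝 y₀ := by
    intro y₀
    have h1 : ∀ᶠ y in 𝓝 y₀, ∀ z ∈ (Set.univ : Set Z), |g (y, z) - g (y₀, z)| < δ := by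
      apply isCompact_univ.eventually_forall_of_forall_eventually
      intro z _
      have hc : Continuous fun q : Y × Z => |g (q.1, q.2) - g (y₀, q.2)| := by fun_prop
      exact (hc.continuousAt (x := (y₀, z))).eventually_lt (continuousAt_const (y := δ))
        (by simpa using hδ)
    filter_upwards [h1] with y hy z using hy z trivial
  obtain ⟨t, ht⟩ := CompactSpace.elim_nhds_subcover _ h
  refine ⟨t, fun y => ?_⟩
  have hy : y ∈ (⊤ : Set Y) := trivial
  rw [← ht] at hy
  simpa using hy

/-- Separated lists of length `n` for a function on `Y × Z`. -/
def SepList {Y Z : Type*} (δ : ℝ) (g : Y × Z → ℝ) (n : ℕ) (u v : ℕ → Y) (w : ℕ → Z) : Prop :=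
  (∀ k < n, 5 * δ < |g (u k, w k) - g (v k, w k)|) ∧
  ∀ k < n, ∀ j < k, |g (u k, w j) - g (v k, w j)| ≤ 3 * δ

lemma sepList_bound {Y Z : Type*} [TopologicalSpace Y] [CompactSpace Y] [TopologicalSpace Z]
    [CompactSpace Z] {g : Y × Z → ℝ} (hg : Continuous g) {δ : ℝ} (hδ : 0 < δ) :
    ∃ N : ℕ, ∀ u v w, ¬ SepList δ g N u v w := by
  obtain ⟨t, ht⟩ := exists_net hg (half_pos hδ)
  choose c hct hc using ht
  refine ⟨(t ×ˢ t).card + 1, ?_⟩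
  rintro u v w ⟨h1, h2⟩
  obtain ⟨m, hm, k, hk, hmk, he⟩ := Finset.exists_ne_map_eq_of_card_lt_of_maps_to
    (s := Finset.range ((t ×ˢ t).card + 1)) (t := t ×ˢ t) (by simp)
    (f := fun k => (c (u k), c (v k))) (by intro k _; simp [hct])
  wlog hlt : m < k generalizing m k
  · exact this k hk m hm hmk.symm he.symm (by omega)
  have a1 := h1 m (Finset.mem_range.mp hm)
  have a2 := h2 k (Finset.mem_range.mp hk) m hlt
  simp only [Prod.mk.injEq] at he
  have b1 := hc (u m) (w m)
  have b2 := hc (u k) (w m)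
  have b3 := hc (v m) (w m)
  have b4 := hc (v k) (w m)
  rw [← he.1] at b2
  rw [← he.2] at b4
  rw [abs_lt] at b1 b2 b3 b4
  rw [abs_le] at a2
  rcases lt_abs.mp a1 with a1 | a1 <;> linarith [b1.1, b1.2, b2.1, b2.2, b3.1, b3.2, b4.1, b4.2]

/-- Theorem 4.4. -/
theorem namioka_of_product_sections {X Y Z : Type*} [TopologicalSpace X]
    [BaireSpace X] [TopologicalSpace Y] [CompactSpace Y] [TopologicalSpace Z]
    [CompactSpace Z]
    (f : X × (Y × Z) → ℝ)
    (hf1 : ∀ p : Y × Z, QuasiContinuous fun x : X => f (x, p))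
    (hf2 : ∀ x : X, Continuous fun p : Y × Z => f (x, p))
    (hfy : ∀ y : Y, NamiokaProperty fun q : X × Z => f (q.1, (y, q.2)))
    (hfz : ∀ z : Z, NamiokaProperty fun q : X × Y => f (q.1, (q.2, z))) :
    NamiokaProperty f := by
  classical
  apply namioka_of_small_osc hf2
  intro B hB U hU hUne
  by_contra hbad
  have hbad' : ∀ W : Set X, IsOpen W → W.Nonempty → W ⊆ U →
      ∃ a ∈ W, ∃ b ∈ W, ∃ y z, B < |f (a, (y, z)) - f (b, (y, z))| := by
    intro W hW hne hWU
    by_contra hcon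
    refine hbad ⟨W, hW, hne, hWU, ?_⟩
    intro x hx x' hx' k
    by_contra hk
    exact hcon ⟨x, hx, x', hx', k.1, k.2, not_le.mp hk⟩
  obtain ⟨δ, hδ, hBδ⟩ : ∃ δ : ℝ, 0 < δ ∧ B = 16 * δ := ⟨B / 16, by positivity, by ring⟩
  have key : ∀ n : ℕ, ∀ V : Set X, IsOpen V → V.Nonempty → V ⊆ U →
      ∃ W : Set X, IsOpen W ∧ W.Nonempty ∧ W ⊆ V ∧ ∃ u v w, ∀ x ∈ W,
        SepList δ (fun p => f (x, p)) n u v w := by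
    intro n
    induction n with
    | zero =>
      intro V hV hne hVU
      obtain ⟨_, _, _, _, y, z, _⟩ := hbad' V hV hne hVU
      exact ⟨V, hV, hne, subset_rfl, fun _ => y, fun _ => y, fun _ => z, fun x _ =>
        ⟨by simp, by simp⟩⟩
    | succ n ih =>
      intro V hV hne hVU
      obtain ⟨W, hW, hWne, hWV, u, v, w, hsep⟩ := ih V hV hne hVU
      obtain ⟨W1, hW1, hW1ne, hW1W, ho1⟩ := namioka_small_osc_finset _ hfz
        ((Finset.range n).image w) hW hWne hδ
      obtain ⟨x0, hx0⟩ := hW1ne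
      obtain ⟨t, ht⟩ := exists_net (hf2 x0) hδ
      obtain ⟨W2, hW2, hW2ne, hW2W1, ho2⟩ := namioka_small_osc_finset _ hfy t hW1 ⟨x0, hx0⟩ hδ
      obtain ⟨a, ha, b, hb, y, z, hab⟩ := hbad' W2 hW2 hW2ne
        (hW2W1.trans (hW1W.trans (hWV.trans hVU)))
      obtain ⟨y', hy't, hy'⟩ := ht y
      have hx : ∃ x ∈ W2, 7 * δ < |f (x, (y, z)) - f (x, (y', z))| := by
        by_contra hcon
        push Not at hcon
        have c1 := abs_le.mp (hcon a ha)
        have c2 := abs_le.mp (hcon b hb)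
        have c3 := abs_le.mp (ho2 y' hy't a ha b hb z)
        dsimp only at c3
        rcases lt_abs.mp hab with h | h <;> linarith [c1.1, c1.2, c2.1, c2.2, c3.1, c3.2]
      obtain ⟨x, hxW, hx⟩ := hx
      obtain ⟨G, hG, hGne, hGW, hGf⟩ := hf1 (y, z) x W2 (hW2.mem_nhds hxW)
        (Metric.ball (f (x, (y, z))) δ) (Metric.ball_mem_nhds _ hδ)
      refine ⟨G, hG, hGne, hGW.trans (hW2W1.trans (hW1W.trans hWV)),
        Function.update u n y, Function.update v n y', Function.update w n z, ?_⟩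
      intro x' hx'
      have hx'2 := hGW hx'
      have hx'1 := hW2W1 hx'2
      obtain ⟨s1, s2⟩ := hsep x' (hW1W hx'1)
      constructor
      · intro k hk
        rcases Nat.lt_succ_iff_lt_or_eq.mp hk with hk | rfl
        · simpa [Function.update_of_ne hk.ne] using s1 k hk
        · simp only [Function.update_self]
          have d1 : |f (x', (y, z)) - f (x, (y, z))| < δ := by
            have := hGf ⟨x', hx', rfl⟩
            simpa [Real.dist_eq] using this
          have d2 := abs_le.mp (ho2 y' hy't x' hx'2 x hxW z)
          dsimp only at d2
          rw [abs_lt] at d1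
          rw [lt_abs] at hx ⊢
          rcases hx with hx | hx
          · left; linarith [d1.1, d1.2, d2.1, d2.2]
          · right; linarith [d1.1, d1.2, d2.1, d2.2]
      · intro k hk j hj
        have hjn : j < n := by omega
        rcases Nat.lt_succ_iff_lt_or_eq.mp hk with hk | rfl
        · simpa [Function.update_of_ne hk.ne, Function.update_of_ne hjn.ne] using s2 k hk j hj
        · simp only [Function.update_self, Function.update_of_ne hjn.ne]
          have hm : w j ∈ (Finset.range k).image w :=
            Finset.mem_image_of_mem _ (Finset.mem_range.mpr hjn)
          have d1 := abs_le.mp (ho1 (w j) hm x' hx'1 x0 hx0 y)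
          have d2 := abs_le.mp (ho1 (w j) hm x' hx'1 x0 hx0 y')
          have d3 := abs_lt.mp (hy' (w j))
          dsimp only at d1 d2
          rw [abs_le]
          constructor <;> linarith [d1.1, d1.2, d2.1, d2.2, d3.1, d3.2]
  let S : ℕ → Set X := fun N => {x | ∀ u v w, ¬ SepList δ (fun p => f (x, p)) N u v w}
  have hS : ⋃ N, closure (S N) = Set.univ := by
    rw [Set.eq_univ_iff_forall]
    intro x
    obtain ⟨N, hN⟩ := sepList_bound (hf2 x) hδ
    exact Set.mem_iUnion.mpr ⟨N, subset_closure hN⟩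
  have hd := dense_iUnion_interior_of_closed (fun N => isClosed_closure (s := S N)) hS
  obtain ⟨x, hxU, hx⟩ := hd.inter_open_nonempty U hU hUne
  obtain ⟨N, hxN⟩ := Set.mem_iUnion.mp hx
  obtain ⟨W, hW, ⟨w0, hw0⟩, hWV, u, v, w, hsep⟩ := key N (U ∩ interior (closure (S N)))
    (hU.inter isOpen_interior) ⟨x, hxU, hxN⟩ Set.inter_subset_left
  obtain ⟨p, hpW, hpS⟩ := mem_closure_iff.mp (interior_subset (hWV hw0).2) W hW hw0
  exact hpS u v w (hsep p hpW)
end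

section
/- Let X be a Baire space and Y a compact space. If every real-valued function on X × Y that is quasi-continuous in the first variable and continuous in the second variable has the Namioka property, then for every metrizable space Z, every mapping f : X × Y → Z that is quasi-continuous in the first variable and continuous in the second variable also has the Namioka property. -/
open Topology

theorem QuasiContinuous.comp_cont {X Y Z : Type*} [TopologicalSpace X] [TopologicalSpace Y]
    [TopologicalSpace Z] {f : X → Y} (hf : QuasiContinuous f) {g : Y → Z} (hg : Continuous g) :
    QuasiContinuous (fun x => g (f x)) := by
  intro x U hU V hV
  obtain ⟨G, h1, h2, h3, h4⟩ := hf x U hU (g ⁻¹' V) (hg.continuousAt hV)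
  refine ⟨G, h1, h2, h3, ?_⟩
  rintro _ ⟨a, ha, rfl⟩
  exact h4 ⟨a, ha, rfl⟩

theorem namioka_sep_bound {Y Z : Type*} [TopologicalSpace Y] [CompactSpace Y] [MetricSpace Z]
    (g : Y → Z) (hg : Continuous g) (ε : ℝ) (hε : 0 < ε) :
    ∃ n : ℕ, ∀ t : Finset Y, (∀ y ∈ t, ∀ y' ∈ t, y ≠ y' → ε ≤ dist (g y) (g y')) →
      t.card ≤ n := by
  obtain ⟨C, hC⟩ := CompactSpace.elim_nhds_subcover (X := Y)
    (fun c => {y | dist (g y) (g c) < ε / 2}) (by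
      intro c
      have : IsOpen {y | dist (g y) (g c) < ε / 2} :=
        isOpen_lt (hg.dist continuous_const) continuous_const
      exact this.mem_nhds (by simp; linarith))
  refine ⟨C.card, fun t ht => ?_⟩
  have hc : ∀ y : Y, ∃ c ∈ C, dist (g y) (g c) < ε / 2 := by
    intro y
    have : y ∈ (⊤ : Set Y) := trivial
    rw [← hC] at this
    simpa using this
  choose c hcC hcd using hc
  refine Finset.card_le_card_of_injOn c (fun y _ => hcC y) ?_
  intro y hy y' hy' heq
  by_contra hne
  have h1 := ht y hy y' hy' hne
  have h2 := hcd y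
  have h3 := hcd y'
  rw [← heq] at h3
  have := dist_triangle_right (g y) (g y') (g (c y))
  linarith

theorem namioka_local_cover {X Y Z : Type*} [TopologicalSpace X] [BaireSpace X]
    [TopologicalSpace Y] [CompactSpace Y] [MetricSpace Z] (f : X × Y → Z)
    (hf1 : ∀ y : Y, QuasiContinuous fun x : X => f (x, y))
    (hf2 : ∀ x : X, Continuous fun y : Y => f (x, y)) (ε : ℝ) (hε : 0 < ε)
    (U : Set X) (hU : IsOpen U) (hne : U.Nonempty) :
    ∃ W ⊆ U, IsOpen W ∧ W.Nonempty ∧ ∃ F : Finset Z, ∀ x ∈ W, ∀ y, ∃ z ∈ F,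
      dist (f (x, y)) z ≤ 2 * ε := by
  classical
  let S : ℕ → Set X := fun n => {x | ∀ t : Finset Y,
    (∀ y ∈ t, ∀ y' ∈ t, y ≠ y' → ε ≤ dist (f (x, y)) (f (x, y'))) → t.card ≤ n}
  have hd : Dense (⋃ n, interior (closure (S n))) := by
    apply dense_iUnion_interior_of_closed (fun n => isClosed_closure)
    rw [Set.eq_univ_iff_forall]
    intro x
    obtain ⟨n, hn⟩ := namioka_sep_bound (fun y => f (x, y)) (hf2 x) ε hε
    exact Set.mem_iUnion.2 ⟨n, subset_closure hn⟩
  obtain ⟨x₀, hx₀U, hx₀⟩ := hd.inter_open_nonempty U hU hne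
  obtain ⟨n, hn⟩ := Set.mem_iUnion.1 hx₀
  by_contra! hcon
  have key : ∀ m : ℕ, ∃ W : Set X, W ⊆ U ∩ interior (closure (S n)) ∧ IsOpen W ∧ W.Nonempty ∧
      ∃ t : Finset Y, t.card = m ∧ ∃ z : Y → Z,
        (∀ y ∈ t, ∀ x ∈ W, dist (f (x, y)) (z y) < ε / 2) ∧
        (∀ y ∈ t, ∀ y' ∈ t, y ≠ y' → 2 * ε < dist (z y) (z y')) := by
    intro m
    induction m with
    | zero =>
      exact ⟨_, subset_rfl, hU.inter isOpen_interior, ⟨x₀, hx₀U, hn⟩, ∅, rfl,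
        fun y => f (x₀, y), by simp, by simp⟩
    | succ m ih =>
      obtain ⟨W, hWs, hWo, hWn, t, htc, z, h1, h2⟩ := ih
      obtain ⟨x, hx, y, hy⟩ := hcon W (hWs.trans Set.inter_subset_left) hWo hWn (t.image z)
      have hy' : ∀ a ∈ t, 2 * ε < dist (f (x, y)) (z a) :=
        fun a ha => hy _ (Finset.mem_image_of_mem z ha)
      have hyt : y ∉ t := fun hyt => by
        have := hy' y hyt
        have := h1 y hyt x hx
        linarith
      obtain ⟨G, hGo, hGn, hGW, hG⟩ := hf1 y x W (hWo.mem_nhds hx)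
        (Metric.ball (f (x, y)) (ε / 2)) (Metric.ball_mem_nhds _ (by linarith))
      refine ⟨G, hGW.trans hWs, hGo, hGn, insert y t, by simp [hyt, htc],
        Function.update z y (f (x, y)), ?_, ?_⟩
      · intro a ha x' hx'
        by_cases hay : a = y
        · subst hay
          simpa using hG ⟨x', hx', rfl⟩
        · rw [Function.update_of_ne hay]
          exact h1 a (Finset.mem_of_mem_insert_of_ne ha hay) x' (hGW hx')
      · intro a ha b hb hab
        by_cases hay : a = y
        · subst hay
          rw [Function.update_self, Function.update_of_ne hab.symm]
          exact hy' b (Finset.mem_of_mem_insert_of_ne hb hab.symm)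
        · by_cases hby : b = y
          · subst hby
            rw [Function.update_self, Function.update_of_ne hay, dist_comm]
            exact hy' a (Finset.mem_of_mem_insert_of_ne ha hay)
          · rw [Function.update_of_ne hay, Function.update_of_ne hby]
            exact h2 a (Finset.mem_of_mem_insert_of_ne ha hay) b
              (Finset.mem_of_mem_insert_of_ne hb hby) hab
  obtain ⟨W, hWs, hWo, ⟨w, hw⟩, t, htc, z, h1, h2⟩ := key (n + 1)
  have hwc : w ∈ closure (S n) := interior_subset (hWs hw).2
  obtain ⟨x, hxW, hxS⟩ := mem_closure_iff.1 hwc W hWo hw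
  have := hxS t (by
    intro y hy y' hy' hne
    have a1 := h1 y hy x hxW
    have a2 := h1 y' hy' x hxW
    have a3 := h2 y hy y' hy' hne
    have := dist_triangle4 (z y) (f (x, y)) (f (x, y')) (z y')
    rw [dist_comm (z y) (f (x, y))] at this
    linarith)
  omega

theorem namioka_metric {X Y : Type*} [TopologicalSpace X] [BaireSpace X]
    [TopologicalSpace Y] [CompactSpace Y]
    (h : ∀ g : X × Y → ℝ,
      (∀ y : Y, QuasiContinuous fun x : X => g (x, y)) →
      (∀ x : X, Continuous fun y : Y => g (x, y)) →
      NamiokaProperty g)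
    {Z : Type*} [MetricSpace Z]
    (f : X × Y → Z)
    (hf1 : ∀ y : Y, QuasiContinuous fun x : X => f (x, y))
    (hf2 : ∀ x : X, Continuous fun y : Y => f (x, y)) :
    NamiokaProperty f := by
  let P : ℝ → Set (X × Y) := fun ε =>
    ⋃₀ {O | IsOpen O ∧ ∀ p ∈ O, ∀ q ∈ O, dist (f p) (f q) < ε}
  have hPo : ∀ ε, IsOpen (P ε) := fun ε => isOpen_sUnion fun O hO => hO.1
  let Q : ℝ → Set X := fun ε => {x | ∀ y, (x, y) ∈ P ε}
  have hQo : ∀ ε, IsOpen (Q ε) := by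
    intro ε
    have := isClosedMap_fst_of_compactSpace (X := X) (Y := Y) _ (hPo ε).isClosed_compl
    rw [← isClosed_compl_iff]
    convert this using 1
    ext x
    simp [Q]
  have hQd : ∀ ε, 0 < ε → Dense (Q ε) := by
    intro ε hε
    rw [dense_iff_inter_open]
    intro U hU hne
    obtain ⟨W, hWU, hWo, hWn, F, hF⟩ :=
      namioka_local_cover f hf1 hf2 (ε / 6) (by linarith) U hU hne
    have hg : ∀ z : Z, NamiokaProperty (fun p => dist (f p) z) := fun z =>
      h _ (fun y => (hf1 y).comp_cont (g := fun w => dist w z) (by fun_prop))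
        (fun x => (hf2 x).dist continuous_const)
    choose A hAd hAG hAc using hg
    have hA : Dense (⋂ z ∈ (F : Set Z), A z) :=
      dense_biInter_of_Gδ (fun z _ => hAG z) F.countable_toSet (fun z _ => hAd z)
    obtain ⟨x, hxW, hxA⟩ := hA.inter_open_nonempty W hWo hWn
    refine ⟨x, hWU hxW, fun y => ?_⟩
    obtain ⟨z, hzF, hz⟩ := hF x hxW y
    have hc := hAc z x (Set.mem_iInter₂.1 hxA z hzF) y
    have hev : ∀ᶠ p in 𝓝 (x, y), dist (f p) z < ε / 2 :=
      hc.eventually_lt continuousAt_const (by linarith)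
    obtain ⟨O, hO, hOo, hxO⟩ := eventually_nhds_iff.1 hev
    refine ⟨O, ⟨hOo, fun p hp q hq => ?_⟩, hxO⟩
    have := dist_triangle_right (f p) (f q) z
    have := hO p hp
    have := hO q hq
    linarith
  refine ⟨⋂ n : ℕ, Q (1 / ((n : ℝ) + 1)),
    dense_iInter_of_isOpen_nat (fun n => hQo _) (fun n => hQd _ (by positivity)),
    IsGδ.iInter_of_isOpen (fun n => hQo _), ?_⟩
  intro x hx y
  rw [Metric.continuousAt_iff']
  intro ε hε
  obtain ⟨n, hn⟩ := exists_nat_one_div_lt hε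
  obtain ⟨O, ⟨hOo, hO⟩, hxO⟩ := Set.mem_iInter.1 hx n y
  filter_upwards [hOo.mem_nhds hxO] with p hp
  exact (hO p hp _ hxO).trans hn

/-- Theorem 5.2, (i) ⇒ (ii). -/
theorem namioka_metrizable_of_namioka_real {X Y : Type*} [TopologicalSpace X] [BaireSpace X]
    [TopologicalSpace Y] [CompactSpace Y]
    (h : ∀ g : X × Y → ℝ,
      (∀ y : Y, QuasiContinuous fun x : X => g (x, y)) →
      (∀ x : X, Continuous fun y : Y => g (x, y)) →
      NamiokaProperty g)
    {Z : Type*} [TopologicalSpace Z] [TopologicalSpace.MetrizableSpace Z]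
    (f : X × Y → Z)
    (hf1 : ∀ y : Y, QuasiContinuous fun x : X => f (x, y))
    (hf2 : ∀ x : X, Continuous fun y : Y => f (x, y)) :
    NamiokaProperty f := by
  let _ := TopologicalSpace.metrizableSpaceMetric Z
  exact namioka_metric h f hf1 hf2
end
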